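/- arXiv:math/0611525 — 4 statements merged into one kernel-verified Lean document; each statement's English description precedes it below -/
import Mathlib

section
/- Let Λ be a nonempty finite set and let M be a complex Λ×Λ matrix such that Re⟨φ, Mφ̄⟩ > 0 for every nonzero φ ∈ ℂ^Λ. Then det(M) ≠ 0, the function (u,v) ↦ exp(−⟨u+iv, M(u−iv)⟩) is Lebesgue integrable on ℝ^Λ × ℝ^Λ, and ∫_{ℝ^Λ×ℝ^Λ} exp(−⟨u+iv, M(u−iv)⟩) du dv = π^{|Λ|}/det(M). -/
open MeasureTheory Finset

open Matrix in
open scoped MatrixOrder ComplexOrder in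
lemma aux_decomp {n : Type*} [Fintype n] [DecidableEq n] (N : Matrix n n ℂ)
    (hN : ∀ φ : n → ℂ, φ ≠ 0 → 0 < (star φ ⬝ᵥ (N *ᵥ φ)).re) :
    ∃ (P : Matrix n n ℂ) (d : n → ℝ), P.det ≠ 0 ∧
      N = Pᴴ * diagonal (fun k => 1 + Complex.I * (d k : ℂ)) * P := by
  set H : Matrix n n ℂ := (1 / 2 : ℂ) • (N + Nᴴ) with hH
  set K : Matrix n n ℂ := (-Complex.I / 2 : ℂ) • (N - Nᴴ) with hK
  have hHH : H.IsHermitian := by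
    ext i j
    simp [hH, conjTranspose_apply, add_comm]
  have hKH : K.IsHermitian := by
    ext i j
    simp [hK, conjTranspose_apply]
    ring
  have hNHK : N = H + Complex.I • K := by
    ext i j
    simp [hH, hK, conjTranspose_apply]
    linear_combination (1 / 2 * (N i j - (starRingEnd ℂ) (N j i))) * Complex.I_sq
  have hstar : ∀ φ : n → ℂ, star φ ⬝ᵥ (Nᴴ *ᵥ φ) = star (star φ ⬝ᵥ (N *ᵥ φ)) := by
    intro φ
    rw [star_dotProduct, star_mulVec, conjTranspose_conjTranspose, dotProduct_mulVec]
  have hpos : H.PosDef := by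
    refine PosDef.of_dotProduct_mulVec_pos hHH fun φ hφ => ?_
    have h1 : star φ ⬝ᵥ (H *ᵥ φ) = (((star φ ⬝ᵥ (N *ᵥ φ)).re : ℝ) : ℂ) := by
      rw [hH, smul_mulVec, dotProduct_smul, add_mulVec, dotProduct_add, hstar]
      apply Complex.ext <;> simp
      ring
    rw [h1]
    exact_mod_cast hN φ hφ
  obtain ⟨B, hB⟩ := CStarAlgebra.nonneg_iff_eq_star_mul_self.mp hpos.posSemidef.nonneg
  rw [star_eq_conjTranspose] at hB
  have hBdet : B.det ≠ 0 := by
    intro h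
    have := (isUnit_iff_isUnit_det _).mp hpos.isUnit
    rw [hB, det_mul, h, mul_zero] at this
    exact not_isUnit_zero this
  have hBu : IsUnit B.det := isUnit_iff_ne_zero.mpr hBdet
  have hK' : ((B⁻¹)ᴴ * K * B⁻¹).IsHermitian := isHermitian_conjTranspose_mul_mul _ hKH
  have hsp := hK'.spectral_theorem
  set U := hK'.eigenvectorUnitary
  set d := hK'.eigenvalues
  rw [Unitary.conjStarAlgAut_apply] at hsp
  have hUU : (U : Matrix n n ℂ) * star (U : Matrix n n ℂ) = 1 := Unitary.coe_mul_star_self U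
  refine ⟨star (U : Matrix n n ℂ) * B, d, ?_, ?_⟩
  · rw [det_mul]
    refine mul_ne_zero ?_ hBdet
    intro h
    have := congrArg det hUU
    rw [det_mul, h] at this
    simp at this
  · have hdiag : diagonal (fun k => 1 + Complex.I * (d k : ℂ))
        = (1 : Matrix n n ℂ) + Complex.I • diagonal (RCLike.ofReal ∘ d) := by
      ext i j
      by_cases hij : i = j
      · subst hij; simp
      · simp [hij]
    have hKeq : K = Bᴴ * ((B⁻¹)ᴴ * K * B⁻¹) * B := by
      have h1 : Bᴴ * (B⁻¹)ᴴ = 1 := by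
        rw [← conjTranspose_mul, nonsing_inv_mul _ hBu, conjTranspose_one]
      have h2 : B⁻¹ * B = 1 := nonsing_inv_mul _ hBu
      calc K = (Bᴴ * (B⁻¹)ᴴ) * K * (B⁻¹ * B) := by rw [h1, h2]; simp
        _ = _ := by simp only [Matrix.mul_assoc]
    rw [hdiag, hNHK]
    rw [hsp] at hKeq
    rw [hKeq, hB]
    simp only [← star_eq_conjTranspose, star_mul, star_star, mul_add, add_mul, mul_one,
      Matrix.mul_smul, Matrix.smul_mul]
    congr 1
    · calc star B * B = star B * ((U : Matrix n n ℂ) * star (U : Matrix n n ℂ)) * B := by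
            rw [hUU]; simp
        _ = _ := by simp only [Matrix.mul_assoc]
    · simp only [Matrix.mul_assoc]

lemma aux_int (n : Type*) [Fintype n] (b : n → ℂ) (hb : ∀ k, 0 < (b k).re) :
    Integrable (fun ψ : n → ℂ => ∏ k, Complex.exp (-b k * (‖ψ k‖ : ℂ) ^ 2)) ∧
    ∫ ψ : n → ℂ, ∏ k, Complex.exp (-b k * (‖ψ k‖ : ℂ) ^ 2) = ∏ k, ((Real.pi : ℂ) / b k) := by
  constructor
  · refine Integrable.fintype_prod (f := fun k (z : ℂ) => Complex.exp (-b k * (‖z‖ : ℂ) ^ 2))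
      fun k => ?_
    simpa using GaussianFourier.integrable_cexp_neg_mul_sq_norm_add (V := ℂ) (hb k) 0 0
  · rw [integral_fintype_prod_volume_eq_prod
      (f := fun k (z : ℂ) => Complex.exp (-b k * (‖z‖ : ℂ) ^ 2))]
    refine Finset.prod_congr rfl fun k _ => ?_
    rw [GaussianFourier.integral_cexp_neg_mul_sq_norm (V := ℂ) (hb k)]
    simp

open Matrix in
lemma aux_change {n : Type*} [Fintype n] [DecidableEq n] (P : Matrix n n ℂ) (hP : P.det ≠ 0)
    (F : (n → ℂ) → ℂ) (hF : Integrable F) :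
    Integrable (fun φ : n → ℂ => F (P *ᵥ φ)) ∧
    ∫ φ : n → ℂ, F (P *ᵥ φ) = ((Complex.normSq P.det)⁻¹ : ℝ) * ∫ φ, F φ := by
  set f : (n → ℂ) →ₗ[ℝ] (n → ℂ) := (Matrix.toLin' P).restrictScalars ℝ with hf
  have hdet : LinearMap.det f = Complex.normSq P.det := by
    rw [hf, LinearMap.det_restrictScalars, LinearMap.det_toLin', Algebra.norm_complex_apply]
  have hdet0 : LinearMap.det f ≠ 0 := by
    rw [hdet]; simpa using hP
  have hmap := Measure.map_linearMap_addHaar_eq_smul_addHaar (volume : Measure (n → ℂ)) hdet0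
  have hcont : Continuous f := f.continuous_of_finiteDimensional
  have hfe : ∀ φ, P *ᵥ φ = f φ := fun φ => by simp [hf]
  have hFm : Integrable F (Measure.map f volume) := by
    rw [hmap]; exact hF.smul_measure ENNReal.ofReal_ne_top
  simp only [hfe]
  refine ⟨hFm.comp_aemeasurable hcont.aemeasurable, ?_⟩
  rw [← integral_map hcont.aemeasurable hFm.aestronglyMeasurable, hmap, integral_smul_measure,
    hdet, ENNReal.toReal_ofReal (abs_nonneg _), abs_of_nonneg (inv_nonneg.mpr (Complex.normSq_nonneg _))]
  rfl

/-- **Complex Gaussian integral (Lemma 2.2).** If `M` is a complex `Λ×Λ` matrix with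
`Re⟨φ, M φ̄⟩ > 0` for all nonzero `φ ∈ ℂ^Λ` (bilinear pairing), then `det M ≠ 0`,
`(u,v) ↦ exp(−⟨u+iv, M (u−iv)⟩)` is Lebesgue integrable on `ℝ^Λ × ℝ^Λ`, and its
integral equals `π^|Λ| / det M`. -/
theorem gaussian_integral_complex_matrix
    {Λ : Type*} [Fintype Λ] [DecidableEq Λ] [Nonempty Λ] (M : Matrix Λ Λ ℂ)
    (hM : ∀ φ : Λ → ℂ, φ ≠ 0 →
      0 < (∑ x, ∑ y, φ x * M x y * (starRingEnd ℂ) (φ y)).re) :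
    M.det ≠ 0 ∧
    MeasureTheory.Integrable (fun p : (Λ → ℝ) × (Λ → ℝ) =>
      Complex.exp (-∑ x, ∑ y,
        ((p.1 x : ℂ) + Complex.I * (p.2 x : ℂ)) * M x y *
          ((p.1 y : ℂ) - Complex.I * (p.2 y : ℂ)))) ∧
    ∫ p : (Λ → ℝ) × (Λ → ℝ),
      Complex.exp (-∑ x, ∑ y,
        ((p.1 x : ℂ) + Complex.I * (p.2 x : ℂ)) * M x y *
          ((p.1 y : ℂ) - Complex.I * (p.2 y : ℂ)))
      = (Real.pi : ℂ) ^ (Fintype.card Λ) / M.det := by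
  classical
  obtain ⟨P, d, hP, hN⟩ := aux_decomp M.transpose (by
    intro φ hφ
    convert hM φ hφ using 2
    simp only [dotProduct, Matrix.mulVec, Finset.mul_sum]
    rw [Finset.sum_comm]
    refine Finset.sum_congr rfl fun x _ => Finset.sum_congr rfl fun y _ => ?_
    simp [Matrix.transpose_apply]
    ring)
  set b : Λ → ℂ := fun k => 1 + Complex.I * (d k : ℂ) with hbdef
  have hb : ∀ k, 0 < (b k).re := by intro k; simp [hbdef]
  have hb0 : ∀ k, b k ≠ 0 := fun k h => by have := hb k; simp [h] at this
  have hdetM : M.det = (Complex.normSq P.det : ℂ) * ∏ k, b k := by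
    rw [← Matrix.det_transpose, hN, Matrix.det_mul, Matrix.det_mul, Matrix.det_conjTranspose,
      Matrix.det_diagonal, Complex.normSq_eq_conj_mul_self]
    simp only [starRingEnd_apply]
    ring
  have hns : (Complex.normSq P.det : ℂ) ≠ 0 := by exact_mod_cast (by simpa using hP)
  have hprod : ∏ k, b k ≠ 0 := Finset.prod_ne_zero_iff.mpr fun k _ => hb0 k
  obtain ⟨hI, hV⟩ := aux_int Λ b hb
  obtain ⟨hI2, hV2⟩ := aux_change P hP _ hI
  have hquad : ∀ φ : Λ → ℂ, (∏ k, Complex.exp (-b k * (‖(P.mulVec φ) k‖ : ℂ) ^ 2))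
      = Complex.exp (-∑ x, ∑ y, φ x * M x y * (starRingEnd ℂ) (φ y)) := by
    intro φ
    rw [← Complex.exp_sum]
    congr 1
    have h1 : ∑ x, ∑ y, φ x * M x y * (starRingEnd ℂ) (φ y)
        = star φ ⬝ᵥ (M.transpose.mulVec φ) := by
      simp only [dotProduct, Matrix.mulVec, Finset.mul_sum]
      rw [Finset.sum_comm]
      refine Finset.sum_congr rfl fun x _ => Finset.sum_congr rfl fun y _ => ?_
      simp [Matrix.transpose_apply]
      ring
    rw [h1, hN, ← Matrix.mulVec_mulVec, ← Matrix.mulVec_mulVec, Matrix.dotProduct_mulVec,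
      ← Matrix.star_mulVec, dotProduct, ← Finset.sum_neg_distrib]
    refine Finset.sum_congr rfl fun k _ => ?_
    rw [Matrix.mulVec_diagonal, ← Complex.conj_mul']
    simp only [Pi.star_apply, starRingEnd_apply]
    ring
  simp only [hquad] at hI2 hV2
  -- transfer to the real coordinates
  have hmp : MeasurePreserving
      (fun (p : (Λ → ℝ) × (Λ → ℝ)) (x : Λ) => Complex.measurableEquivRealProd.symm (p.1 x, p.2 x))
      volume volume :=
    (volume_preserving_pi fun _ : Λ => Complex.volume_preserving_equiv_real_prod.symm).comp
      (volume_measurePreserving_arrowProdEquivProdArrow ℝ ℝ Λ).symm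
  have hfun : ∀ p : (Λ → ℝ) × (Λ → ℝ), Complex.exp (-∑ x, ∑ y,
        ((p.1 x : ℂ) + Complex.I * (p.2 x : ℂ)) * M x y *
          ((p.1 y : ℂ) - Complex.I * (p.2 y : ℂ)))
      = (fun φ : Λ → ℂ => Complex.exp (-∑ x, ∑ y, φ x * M x y * (starRingEnd ℂ) (φ y)))
        (fun x => Complex.measurableEquivRealProd.symm (p.1 x, p.2 x)) := by
    intro p
    have h2 : ∀ x, Complex.measurableEquivRealProd.symm (p.1 x, p.2 x)
        = (p.1 x : ℂ) + Complex.I * (p.2 x : ℂ) := by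
      intro x
      rw [Complex.measurableEquivRealProd_symm_apply]
      apply Complex.ext <;> simp
    simp only [h2]
    simp [sub_eq_add_neg]
  simp only [hfun]
  refine ⟨by rw [hdetM]; exact mul_ne_zero hns hprod, hmp.integrable_comp_of_integrable hI2, ?_⟩
  have hmapint := integral_map hmp.measurable.aemeasurable
    (by rw [hmp.map_eq]; exact hI2.aestronglyMeasurable)
  rw [hmp.map_eq] at hmapint
  refine hmapint.symm.trans ?_
  rw [hV2, hV, hdetM, Finset.prod_div_distrib, Finset.prod_const, Finset.card_univ]
  push_cast
  field_simp
end

section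
/- Let R be a finite set, let a, b ∈ R, let M be a complex R×R matrix, and let w ∈ ℂ^R with W the diagonal matrix having entries W_{x,x} = w_x. Then det_{ab}^{(R)}(M+W) = Σ_{Q ⊆ R∖{a,b}} (∏_{x∈Q} w_x) · det_{ab}^{(R∖Q)}(M_{(R∖Q)×(R∖Q)}), where M_{(R∖Q)×(R∖Q)} is the submatrix of M indexed by R∖Q. -/
open Finset

noncomputable section

/-- The `(b,a)` cofactor of the `S × S` submatrix of `M`: the determinant of the matrix on
`S` whose `(x,y)` entry is `M x y` for `x ≠ b`, `y ≠ a`, is `1` at `(b,a)`, and `0`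
elsewhere in row `b` or column `a`. -/
def cofDet {α : Type*} [Fintype α] [DecidableEq α]
    (S : Finset α) (M : Matrix α α ℂ) (a b : α) : ℂ :=
  (Matrix.of fun x y : S => if (x : α) = b then (if (y : α) = a then (1:ℂ) else 0)
    else (if (y : α) = a then 0 else M x y)).det

theorem det_add_diagonal_aux {R : Type*} [Fintype R] [DecidableEq R]
    (N : Matrix R R ℂ) (w : R → ℂ) :
    (N + Matrix.diagonal w).det = ∑ Q : Finset R, (∏ x ∈ Q, w x) *
      (N.submatrix (fun x : (univ \ Q : Finset R) => (x : R)) (fun x : (univ \ Q : Finset R) => (x : R))).det := by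
  have h := (Matrix.detRowAlternating (n := R) (R := ℂ)).map_add_univ (Matrix.diagonal w) N
  have h0 : (N + Matrix.diagonal w).det
      = Matrix.detRowAlternating (n := R) (R := ℂ) (Matrix.diagonal w + N) := by
    rw [add_comm]; rfl
  rw [h0]
  refine h.trans (Finset.sum_congr rfl fun Q _ => ?_)
  let P : Matrix R R ℂ := Q.piecewise (Matrix.diagonal w) N
  have hP : ∀ i j, P i j = if i ∈ Q then Matrix.diagonal w i j else N i j := by
    intro i j
    by_cases hi : i ∈ Q <;> simp [P, Finset.piecewise, hi]
  change P.det = _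
  rw [Matrix.twoBlockTriangular_det P (fun x => x ∈ univ \ Q)]
  · rw [mul_comm]
    congr 1
    · have : P.toSquareBlockProp (fun i => ¬ i ∈ univ \ Q)
          = Matrix.diagonal (fun i : {x : R // ¬ x ∈ univ \ Q} => w (i : R)) := by
        ext i j
        have hi : (i : R) ∈ Q := by simpa using i.2
        simp [Matrix.toSquareBlockProp_def, hP, hi, Matrix.diagonal_apply, Subtype.ext_iff]
      rw [this, Matrix.det_diagonal]
      symm
      exact Finset.prod_subtype Q (by simp) w
    · have : P.toSquareBlockProp (fun i => i ∈ univ \ Q)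
          = N.submatrix (fun x : (univ \ Q : Finset R) => (x : R)) (fun x : (univ \ Q : Finset R) => (x : R)) := by
        ext i j
        have hi : (i : R) ∉ Q := (Finset.mem_sdiff.1 i.2).2
        simp [Matrix.toSquareBlockProp_def, hP, hi]
      rw [this]
      congr!
  · intro i hi j hj
    have hi' : i ∈ Q := by simpa using hi
    have hj' : j ∉ Q := by simpa using hj
    have hne : i ≠ j := fun e => hj' (e ▸ hi')
    simp [hP, hi', hne]

/-- **Cofactor expansion of `det_{ab}(M + W)` for a diagonal matrix `W` (proof of
Lemma 2.4).** `det_{ab}^{(R)}(M+W) = Σ_{Q ⊆ R∖{a,b}} (∏_{x∈Q} w_x) ·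
det_{ab}^{(R∖Q)}(M_{(R∖Q)×(R∖Q)})`. -/
theorem cofDet_add_diagonal {R : Type*} [Fintype R] [DecidableEq R]
    (M : Matrix R R ℂ) (a b : R) (w : R → ℂ) :
    cofDet (Finset.univ : Finset R) (M + Matrix.diagonal w) a b
      = ∑ Q ∈ ((Finset.univ : Finset R) \ {a, b}).powerset,
          (∏ x ∈ Q, w x) * cofDet ((Finset.univ : Finset R) \ Q) M a b := by
  let N : Matrix R R ℂ := Matrix.of fun x y => if x = b then (if y = a then (1:ℂ) else 0)
    else (if y = a then 0 else M x y)
  let w' : R → ℂ := fun x => if x ∈ ({a, b} : Finset R) then 0 else w x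
  have h1 : cofDet (Finset.univ : Finset R) (M + Matrix.diagonal w) a b
      = (N + Matrix.diagonal w').det := by
    rw [← Matrix.det_submatrix_equiv_self (Equiv.subtypeUnivEquiv (Finset.mem_univ (α := R)))]
    unfold cofDet
    congr 1
    ext ⟨x, hx⟩ ⟨y, hy⟩
    simp only [N, w', Matrix.of_apply, Matrix.submatrix_apply, Matrix.add_apply,
      Matrix.diagonal_apply, Equiv.subtypeUnivEquiv_apply, Finset.mem_insert,
      Finset.mem_singleton]
    split_ifs <;> simp_all
  rw [h1, det_add_diagonal_aux]
  symm
  rw [← Finset.sum_subset (Finset.subset_univ ((Finset.univ \ {a, b} : Finset R).powerset))]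
  · refine Finset.sum_congr rfl fun Q hQ => ?_
    congr 1
    refine Finset.prod_congr rfl fun x hx => ?_
    have := Finset.mem_powerset.1 hQ hx
    rw [Finset.mem_sdiff] at this
    simp only [w', if_neg this.2]
  · intro Q _ hQ
    rw [Finset.mem_powerset, Finset.not_subset] at hQ
    obtain ⟨x, hx, hx'⟩ := hQ
    have hx2 : x ∈ ({a, b} : Finset R) := by
      by_contra hc
      exact hx' (Finset.mem_sdiff.2 ⟨Finset.mem_univ _, hc⟩)
    rw [Finset.prod_eq_zero hx (by simp only [w', if_pos hx2]), zero_mul]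

end
end

section
/- Let R be a finite set, a, b ∈ R, M a complex R×R matrix, v ∈ ℂ^R with V the diagonal matrix having entries V_{x,x} = v_x, and let g : ℝ^R → ℂ be infinitely differentiable. Then for every l ∈ ℝ^R: (det_{ab}^{(R)}(M + ∂_l)(e^{⟨v,·⟩} g))(l) = e^{⟨v,l⟩} · (det_{ab}^{(R)}(M + V + ∂_l) g)(l), where ⟨v,l⟩ = Σ_{x∈R} v_x l_x. -/
open Finset

noncomputable section

/-- Partial derivative in direction `x`. -/
def pd {α : Type*} [Fintype α] [DecidableEq α] (x : α) (f : (α → ℝ) → ℂ) :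
    (α → ℝ) → ℂ :=
  fun l => fderiv ℝ f l (Pi.single x 1)

/-- Mixed partial derivative `∂^Q f`, one derivative in each coordinate of `Q`. -/
def mpart {α : Type*} [Fintype α] [DecidableEq α] (Q : Finset α) (f : (α → ℝ) → ℂ) :
    (α → ℝ) → ℂ :=
  Q.toList.foldr pd f

/-- The differential operator `det_{ab}^{(α)}(M + ∂_l)` applied to `f` at `l`. -/
def ddet {α : Type*} [Fintype α] [DecidableEq α]
    (M : Matrix α α ℂ) (a b : α) (f : (α → ℝ) → ℂ) (l : α → ℝ) : ℂ :=
  ∑ Q ∈ ((Finset.univ : Finset α) \ {a, b}).powerset,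
    cofDet ((Finset.univ : Finset α) \ Q) M a b * mpart Q f l

/-- Row-padded full matrix whose determinant is `cofDet`. -/
def fullMat {α : Type*} [DecidableEq α]
    (S : Finset α) (M : Matrix α α ℂ) (a b : α) : Matrix α α ℂ :=
  Matrix.of fun x y => if x ∈ S then (if x = b then (if y = a then (1:ℂ) else 0)
    else (if y = a then 0 else M x y)) else if x = y then 1 else 0

lemma cofDet_eq_full {α : Type*} [Fintype α] [DecidableEq α]
    (S : Finset α) (M : Matrix α α ℂ) (a b : α) :
    cofDet S M a b = (fullMat S M a b).det := by
  rw [Matrix.twoBlockTriangular_det (fullMat S M a b) (fun x => x ∈ S)]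
  · have h2 : (Matrix.toSquareBlockProp (fullMat S M a b) fun x => ¬ x ∈ S) = 1 := by
      ext ⟨x, hx⟩ ⟨y, hy⟩
      simp [Matrix.toSquareBlockProp_def, fullMat, hx, Matrix.one_apply]
    rw [h2, Matrix.det_one, mul_one, cofDet]
    have h1 : ∀ A B : Matrix S S ℂ, A = B → A.det = B.det := fun A B h => by rw [h]
    have h3 : (Matrix.of fun x y : S => if (x : α) = b then (if (y : α) = a then (1:ℂ) else 0)
        else (if (y : α) = a then 0 else M x y))
        = Matrix.toSquareBlockProp (fullMat S M a b) fun x => x ∈ S := by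
      ext ⟨x, hx⟩ ⟨y, hy⟩
      simp [Matrix.toSquareBlockProp_def, fullMat, hx]
    rw [h3]
    convert rfl
  · intro i hi j hj
    have : i ≠ j := fun h => hi (h ▸ hj)
    simp [fullMat, hi, this]

lemma cofDet_add_diag {α : Type*} [Fintype α] [DecidableEq α]
    (S : Finset α) (M : Matrix α α ℂ) (a b : α) (v : α → ℂ) :
    cofDet S (M + Matrix.diagonal v) a b =
      ∑ T ∈ (S \ {a, b}).powerset, (∏ x ∈ T, v x) * cofDet (S \ T) M a b := by
  simp only [cofDet_eq_full]
  have h0 : fullMat S (M + Matrix.diagonal v) a b =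
      (S \ {a, b}).piecewise ((fun x => v x • (Pi.single x 1 : α → ℂ)) + fun x => fullMat S M a b x)
        (fun x => fullMat S M a b x) := by
    funext x y
    by_cases hx : x ∈ S \ {a, b}
    · rw [Finset.piecewise_eq_of_mem _ _ _ hx]
      simp only [mem_sdiff, mem_insert, mem_singleton, not_or] at hx
      obtain ⟨hS, ha, hb⟩ := hx
      by_cases hy : y = a
      · subst hy
        simp [fullMat, hS, hb, Ne.symm ha]
      · by_cases hxy : x = y
        · subst hxy
          simp [fullMat, hS, hb, hy, add_comm]
        · simp [fullMat, hS, hb, hy, hxy, Ne.symm hxy]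
    · rw [Finset.piecewise_eq_of_notMem _ _ _ hx]
      simp only [mem_sdiff, mem_insert, mem_singleton, not_and, not_not] at hx
      by_cases hS : x ∈ S
      · by_cases hb : x = b
        · simp [fullMat, hS, hb]
        · have ha : x = a := by have := hx hS; tauto
          subst ha
          by_cases hy : y = x
          · simp [fullMat, hS, hb, hy]
          · simp [fullMat, hS, hb, hy, Ne.symm hy]
      · simp [fullMat, hS]
  have h1 := (Matrix.detRowAlternating (n := α) (R := ℂ)).toMultilinearMap.map_piecewise_add
    (fun x => v x • (Pi.single x 1 : α → ℂ)) (fun x => fullMat S M a b x) (S \ {a, b})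
  rw [← h0] at h1
  refine h1.trans (Finset.sum_congr rfl fun T hT => ?_)
  rw [mem_powerset] at hT
  have h2 := (Matrix.detRowAlternating (n := α) (R := ℂ)).toMultilinearMap.map_piecewise_smul
    v (fun x => fullMat (S \ T) M a b x) T
  refine Eq.trans ?_ h2
  congr 1
  funext x y
  by_cases hx : x ∈ T
  · rw [Finset.piecewise_eq_of_mem _ _ _ hx, Finset.piecewise_eq_of_mem _ _ _ hx]
    by_cases hxy : x = y
    · subst hxy
      simp [hx, fullMat]
    · simp [hx, fullMat, hxy, Ne.symm hxy]
  · rw [Finset.piecewise_eq_of_notMem _ _ _ hx, Finset.piecewise_eq_of_notMem _ _ _ hx]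
    simp [hx, fullMat]

section Deriv

variable {α : Type*} [Fintype α] [DecidableEq α]

lemma pd_smooth (x : α) {f : (α → ℝ) → ℂ} (hf : ContDiff ℝ (⊤ : ℕ∞) f) :
    ContDiff ℝ (⊤ : ℕ∞) (pd x f) := by
  unfold pd
  exact (hf.fderiv_right (m := (⊤ : ℕ∞)) (by simp)).clm_apply contDiff_const

lemma foldr_smooth (L : List α) {f : (α → ℝ) → ℂ} (hf : ContDiff ℝ (⊤ : ℕ∞) f) :
    ContDiff ℝ (⊤ : ℕ∞) (L.foldr pd f) := by
  induction L with
  | nil => exact hf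
  | cons x L ih => exact pd_smooth x ih

lemma pd_comm (x y : α) {f : (α → ℝ) → ℂ} (hf : ContDiff ℝ (⊤ : ℕ∞) f) :
    pd x (pd y f) = pd y (pd x f) := by
  have h2 : ContDiff ℝ (⊤ : ℕ∞) (fderiv ℝ f) := hf.fderiv_right (m := (⊤ : ℕ∞)) (by simp)
  have hd : Differentiable ℝ (fderiv ℝ f) := h2.differentiable (by simp)
  have key : ∀ (x y : α) l, pd x (pd y f) l
      = fderiv ℝ (fderiv ℝ f) l (Pi.single x 1) (Pi.single y 1) := by
    intro x y l
    unfold pd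
    rw [fderiv_clm_apply (hd l) (differentiableAt_const _)]
    simp
  funext l
  rw [key, key]
  exact (hf.contDiffAt (x := l)).isSymmSndFDerivAt (by
    rw [minSmoothness_of_isRCLikeNormedField]; exact WithTop.coe_le_coe.2 (le_top : (2 : ℕ∞) ≤ ⊤)) _ _

lemma foldr_perm {L L' : List α} (h : L.Perm L') {f : (α → ℝ) → ℂ}
    (hf : ContDiff ℝ (⊤ : ℕ∞) f) : L.foldr pd f = L'.foldr pd f := by
  induction h with
  | nil => rfl
  | cons x _ ih => simp [ih]
  | swap x y L => exact pd_comm _ _ (foldr_smooth L hf)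
  | trans _ _ h1 h2 => exact h1.trans h2

lemma mpart_insert {x : α} {Q : Finset α} (hx : x ∉ Q) {f : (α → ℝ) → ℂ}
    (hf : ContDiff ℝ (⊤ : ℕ∞) f) : mpart (insert x Q) f = pd x (mpart Q f) :=
  foldr_perm (Finset.toList_insert hx) hf

lemma mpart_exp (v : α → ℂ) {g : (α → ℝ) → ℂ} (hg : ContDiff ℝ (⊤ : ℕ∞) g) (Q : Finset α) :
    mpart Q (fun l' => Complex.exp (∑ x, v x * (l' x : ℂ)) * g l') =
      fun l => Complex.exp (∑ x, v x * (l x : ℂ)) *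
        ∑ P ∈ Q.powerset, (∏ x ∈ Q \ P, v x) * mpart P g l := by
  have hlin : ∀ l : α → ℝ, HasFDerivAt (fun l : α → ℝ => ∑ x, v x * (l x : ℂ))
      (∑ x, v x • (Complex.ofRealCLM.comp
        (ContinuousLinearMap.proj x : (α → ℝ) →L[ℝ] ℝ))) l := by
    intro l
    refine HasFDerivAt.fun_sum fun x _ => ?_
    exact ((Complex.ofRealCLM.comp
        (ContinuousLinearMap.proj x : (α → ℝ) →L[ℝ] ℝ)).hasFDerivAt (x := l)).const_mul (v x)
  have hlinS : ContDiff ℝ (⊤ : ℕ∞) (fun l : α → ℝ => ∑ x, v x * (l x : ℂ)) := by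
    refine ContDiff.sum fun x _ => contDiff_const.mul ?_
    exact (Complex.ofRealCLM.comp
        (ContinuousLinearMap.proj x : (α → ℝ) →L[ℝ] ℝ)).contDiff
  have hE : ContDiff ℝ (⊤ : ℕ∞) (fun l' => Complex.exp (∑ x, v x * (l' x : ℂ)) * g l') :=
    hlinS.cexp.mul hg
  induction Q using Finset.induction_on with
  | empty => funext l; simp [mpart]
  | insert x Q hx ih =>
    rw [mpart_insert hx hE, ih]
    funext l
    have hs : HasFDerivAt (fun l => ∑ P ∈ Q.powerset, (∏ x ∈ Q \ P, v x) * mpart P g l)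
        (∑ P ∈ Q.powerset, (∏ x ∈ Q \ P, v x) • fderiv ℝ (mpart P g) l) l := by
      refine HasFDerivAt.fun_sum fun P _ => ?_
      have hP : ContDiff ℝ (⊤ : ℕ∞) (mpart P g) := foldr_smooth _ hg
      exact ((hP.differentiable (by simp)) l).hasFDerivAt.const_mul _
    have hp := ((hlin l).cexp.mul hs).fderiv
    have hv : (∑ y, v y • (Complex.ofRealCLM.comp
        (ContinuousLinearMap.proj y : (α → ℝ) →L[ℝ] ℝ))) (Pi.single x 1) = v x := by
      simp only [_root_.sum_apply, _root_.smul_apply,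
        ContinuousLinearMap.comp_apply, ContinuousLinearMap.proj_apply, Complex.ofRealCLM_apply]
      rw [Finset.sum_eq_single x]
      · simp
      · intro y _ hy; simp [hy]
      · simp
    have e1 : pd x (fun l => Complex.exp (∑ x, v x * (l x : ℂ)) *
        ∑ P ∈ Q.powerset, (∏ x ∈ Q \ P, v x) * mpart P g l) l =
        Complex.exp (∑ x, v x * (l x : ℂ)) *
          (∑ P ∈ Q.powerset, (∏ x ∈ Q \ P, v x) * pd x (mpart P g) l) +
        (∑ P ∈ Q.powerset, (∏ x ∈ Q \ P, v x) * mpart P g l) *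
          (Complex.exp (∑ x, v x * (l x : ℂ)) * v x) := by
      refine (congrArg (fun A => A (Pi.single x 1)) hp).trans ?_
      rw [_root_.add_apply, _root_.smul_apply,
        _root_.smul_apply, _root_.smul_apply, hv]
      simp [_root_.sum_apply, pd]
    rw [e1, Finset.sum_powerset_insert hx]
    have a1 : ∑ P ∈ Q.powerset, (∏ y ∈ insert x Q \ P, v y) * mpart P g l =
        v x * ∑ P ∈ Q.powerset, (∏ y ∈ Q \ P, v y) * mpart P g l := by
      rw [Finset.mul_sum]
      refine Finset.sum_congr rfl fun P hP => ?_
      have hxP : x ∉ P := fun h => hx (mem_powerset.1 hP h)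
      rw [Finset.insert_sdiff_of_notMem _ hxP, Finset.prod_insert (by simp [hx]), mul_assoc]
    have a2 : ∑ P ∈ Q.powerset, (∏ y ∈ insert x Q \ insert x P, v y) * mpart (insert x P) g l =
        ∑ P ∈ Q.powerset, (∏ y ∈ Q \ P, v y) * pd x (mpart P g) l := by
      refine Finset.sum_congr rfl fun P hP => ?_
      have hxP : x ∉ P := fun h => hx (mem_powerset.1 hP h)
      have : insert x Q \ insert x P = Q \ P := by
        ext y; simp only [mem_sdiff, mem_insert]
        by_cases hy : y = x
        · subst hy; simp [hx]
        · simp [hy]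
      rw [mpart_insert hxP hg, this]
    rw [a1, a2]
    ring

end Deriv

/-- **Lemma 2.4.** For any matrix `M`, any `v ∈ ℂ^R` with associated diagonal matrix `V`,
and any smooth `g : ℝ^R → ℂ`,
`(det_{ab}(M + ∂_l)(e^{⟨v,·⟩} g))(l) = e^{⟨v,l⟩} (det_{ab}(M + V + ∂_l) g)(l)`. -/
theorem ddet_exp_mul {R : Type*} [Fintype R] [DecidableEq R]
    (M : Matrix R R ℂ) (a b : R) (v : R → ℂ)
    (g : (R → ℝ) → ℂ) (hg : ContDiff ℝ (⊤ : ℕ∞) g) (l : R → ℝ) :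
    ddet M a b (fun l' => Complex.exp (∑ x, v x * (l' x : ℂ)) * g l') l
      = Complex.exp (∑ x, v x * (l x : ℂ)) *
        ddet (M + Matrix.diagonal v) a b g l := by
  unfold ddet
  simp only [mpart_exp v hg, cofDet_add_diag, Finset.mul_sum, Finset.sum_mul]
  rw [Finset.sum_sigma', Finset.sum_sigma']
  refine Finset.sum_bij' (fun p _ => ⟨p.2, p.1 \ p.2⟩) (fun p _ => ⟨p.1 ∪ p.2, p.1⟩) ?_ ?_ ?_ ?_ ?_
  · rintro ⟨Q, P⟩ h
    simp only [mem_sigma, mem_powerset] at h ⊢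
    refine ⟨h.2.trans h.1, fun x hx => ?_⟩
    have := h.1 (mem_sdiff.1 hx).1
    simp only [mem_sdiff, mem_univ, true_and] at hx this ⊢
    exact ⟨hx.2, this⟩
  · rintro ⟨P, T⟩ h
    simp only [mem_sigma, mem_powerset] at h ⊢
    refine ⟨union_subset h.1 fun x hx => ?_, subset_union_left⟩
    have := h.2 hx
    simp only [mem_sdiff, mem_univ, true_and] at this ⊢
    exact this.2
  · rintro ⟨Q, P⟩ h
    simp only [mem_sigma, mem_powerset] at h
    simp [Finset.union_sdiff_of_subset h.2]
  · rintro ⟨P, T⟩ h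
    simp only [mem_sigma, mem_powerset] at h
    have hd : Disjoint P T := by
      rw [Finset.disjoint_right]
      intro x hx
      have := h.2 hx
      simp only [mem_sdiff, mem_univ, true_and] at this
      exact this.1
    simp [Finset.union_sdiff_cancel_left hd]
  · rintro ⟨Q, P⟩ h
    simp only [mem_sigma, mem_powerset] at h
    have : (univ \ P) \ (Q \ P) = univ \ Q := by
      rw [sdiff_sdiff, Finset.sup_eq_union, Finset.union_sdiff_of_subset h.2]
    simp only [this]
    ring

end
end

section
/- Let R be a finite set, a, b ∈ R, let A be any real R×R matrix, let B be its off-diagonal part (B_{x,y} = A_{x,y} for x ≠ y and B_{x,x} = 0), and let r ∈ (0,∞)^R. Define B^{(r)} by B^{(r)}_{x,y} = r_x B_{x,y} r_y^{-1}. Then for every l ∈ (0,∞)^R: (det_{ab}^{(R)}(−A + ∂_l) G_A)(l) = exp(Σ_{x∈R} l_x A_{x,x}) · (det_{ab}^{(R)}(−B + ∂_l) G_{B^{(r)}})(l). -/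
open MeasureTheory Finset

noncomputable section

/-- `G_M(l) = ∫_{[0,2π]^α} exp(Σ_{x,y} M_{x,y} √(l_x l_y) e^{i(θ_x−θ_y)}) ∏ dθ_x/(2π)`. -/
def GM {α : Type*} [Fintype α] [DecidableEq α] (M : Matrix α α ℝ) (l : α → ℝ) : ℂ :=
  ((2 * Real.pi : ℂ) ^ (Fintype.card α))⁻¹ *
    ∫ θ in Set.univ.pi (fun _ : α => Set.Icc (0:ℝ) (2 * Real.pi)),
      Complex.exp (∑ x, ∑ y, (M x y : ℂ) * (Real.sqrt (l x * l y) : ℂ) *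
        Complex.exp (Complex.I * ((θ x : ℂ) - (θ y : ℂ))))

/-- The local-time density `ρ_{ab}(l) = (det_{ab}(−A + ∂_l) G_A)(l)`. -/
def rho {α : Type*} [Fintype α] [DecidableEq α]
    (A : Matrix α α ℝ) (a b : α) (l : α → ℝ) : ℂ :=
  ddet ((-A).map (fun r => (r : ℂ))) a b (GM A) l

lemma cofDet_step {α : Type*} [Fintype α] [DecidableEq α]
    (S : Finset α) (M N : Matrix α α ℂ) (a b x : α) (d : ℂ) (hxS : x ∈ S) (hxa : x ≠ a)
    (hxb : x ≠ b) (hN : ∀ u v, N u v = M u v + if u = x ∧ v = x then d else 0) :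
    cofDet S N a b = cofDet S M a b + d * cofDet (S.erase x) M a b := by
  set P : Matrix S S ℂ := Matrix.of fun x y : S =>
    if (x : α) = b then (if (y : α) = a then (1:ℂ) else 0)
    else (if (y : α) = a then 0 else M x y) with hP
  set xs : S := ⟨x, hxS⟩ with hxs
  have h1 : cofDet S N a b = (P.updateRow xs (P xs + d • Pi.single xs 1)).det := by
    unfold cofDet
    congr 1
    ext u v
    rw [Matrix.updateRow_apply]
    by_cases hu : u = xs
    · subst hu
      by_cases hv : v = xs
      · subst hv
        simp [hP, hN, hxs, hxa, hxb]
      · have : (v : α) ≠ x := fun h => hv (Subtype.ext h)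
        simp [hP, hN, hxb, this, hv, show (xs : α) = x from rfl]
    · have : (u : α) ≠ x := fun h => hu (Subtype.ext h)
      simp [hP, hN, this, hu]
  rw [h1, Matrix.det_updateRow_add, Matrix.updateRow_eq_self, Matrix.det_updateRow_smul]
  have h2 : (P.updateRow xs (Pi.single xs 1)).det = cofDet (S.erase x) M a b := by
    rw [Matrix.twoBlockTriangular_det _ (fun u : S => u ≠ xs)]
    · have h3 : (Matrix.toSquareBlockProp (P.updateRow xs (Pi.single xs 1))
          (fun u : S => ¬ (u ≠ xs))).det = 1 := by
        have : Matrix.toSquareBlockProp (P.updateRow xs (Pi.single xs 1))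
          (fun u : S => ¬ (u ≠ xs)) = 1 := by
          ext ⟨u, hu⟩ ⟨v, hv⟩
          simp only [ne_eq, not_not] at hu hv
          subst hu; subst hv
          simp [Matrix.toSquareBlockProp]
        rw [this, Matrix.det_one]
      rw [h3, mul_one]
      unfold cofDet
      let e : {u : S // u ≠ xs} ≃ (S.erase x : Finset α) :=
        { toFun := fun u => ⟨u.1.1, Finset.mem_erase.2 ⟨fun h => u.2 (Subtype.ext h), u.1.2⟩⟩
          invFun := fun v => ⟨⟨v.1, Finset.mem_of_mem_erase v.2⟩,
            fun h => Finset.ne_of_mem_erase v.2 (congrArg Subtype.val h)⟩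
          left_inv := fun u => rfl
          right_inv := fun v => rfl }
      rw [← Matrix.det_submatrix_equiv_self e]
      congr 1
      ext u v
      simp [Matrix.toSquareBlockProp, Matrix.updateRow_apply, u.2, hP, e]
    · intro u hu v hv
      simp only [ne_eq, not_not] at hu
      subst hu
      simp [hv]
  rw [h2]
  rfl

lemma cofDet_expand {α : Type*} [Fintype α] [DecidableEq α]
    (a b : α) (d : α → ℂ) (M : Matrix α α ℂ) (T : Finset α) :
    ∀ (S : Finset α), T ⊆ S → a ∉ T → b ∉ T → 
    cofDet S (Matrix.of fun u v => M u v + if u = v ∧ u ∈ T then d u else 0) a b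
      = ∑ Q ∈ T.powerset, (∏ x ∈ Q, d x) * cofDet (S \ Q) M a b := by
  induction T using Finset.induction_on with
  | empty => intro S _ _ _; simp; rfl
  | insert x T hx ih =>
    intro S hS ha hb
    simp only [Finset.mem_insert, not_or] at ha hb
    have hxS : x ∈ S := hS (Finset.mem_insert_self _ _)
    have hTS : T ⊆ S := (Finset.subset_insert _ _).trans hS
    rw [cofDet_step S (Matrix.of fun u v => M u v + if u = v ∧ u ∈ T then d u else 0) _ a b x (d x)
      hxS (Ne.symm ha.1) (Ne.symm hb.1), ih S hTS ha.2 hb.2, ih (S.erase x) _ ha.2 hb.2,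
      Finset.sum_powerset_insert hx, Finset.mul_sum]
    · congr 1
      refine Finset.sum_congr rfl fun Q hQ => ?_
      have hxQ : x ∉ Q := fun h => hx (Finset.mem_powerset.1 hQ h)
      rw [Finset.prod_insert hxQ, mul_assoc]
      congr 3
      ext u; simp only [Finset.mem_sdiff, Finset.mem_erase, Finset.mem_insert]; tauto
    · intro u hu
      exact Finset.mem_erase.2 ⟨fun h => hx (h ▸ hu), hTS hu⟩
    · intro u v
      simp only [Matrix.of_apply, Finset.mem_insert]
      by_cases huv : u = v
      · subst huv
        by_cases hux : u = x
        · subst hux; simp [hx]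
        · simp [hux]
      · have : ¬ (u = x ∧ v = x) := fun h => huv (h.1.trans h.2.symm)
        simp [huv, this]

/-- Independence of the diagonal outside the relevant entries. -/
lemma cofDet_congr {α : Type*} [Fintype α] [DecidableEq α]
    (S : Finset α) (M N : Matrix α α ℂ) (a b : α)
    (h : ∀ u v, u ≠ b → v ≠ a → u ∈ S → v ∈ S → M u v = N u v) :
    cofDet S M a b = cofDet S N a b := by
  unfold cofDet
  congr 1
  ext u v
  simp only [Matrix.of_apply]
  split_ifs with h1 h2 h3
  · rfl
  · rfl
  · rfl
  · exact h _ _ h1 h3 u.2 v.2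
lemma torus_mode {R : Type*} [Fintype R] [DecidableEq R] (N : R → ℤ) (ρ : R → ℂ) :
    ∫ θ in Set.univ.pi (fun _ : R => Set.Icc (0:ℝ) (2 * Real.pi)),
      Complex.exp (∑ x, (N x : ℂ) * (ρ x + Complex.I * (θ x : ℂ)))
    = ∫ θ in Set.univ.pi (fun _ : R => Set.Icc (0:ℝ) (2 * Real.pi)),
      Complex.exp (∑ x, (N x : ℂ) * (Complex.I * (θ x : ℂ))) := by
  simp_rw [Complex.exp_sum, volume_pi, Measure.restrict_pi_pi]
  rw [integral_fintype_prod_eq_prod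
      (f := fun x (t : ℝ) => Complex.exp ((N x : ℂ) * (ρ x + Complex.I * (t : ℂ)))),
    integral_fintype_prod_eq_prod
      (f := fun x (t : ℝ) => Complex.exp ((N x : ℂ) * (Complex.I * (t : ℂ))))]
  refine Finset.prod_congr rfl fun x _ => ?_
  by_cases hN : N x = 0
  · simp [hN]
  · have h0 : ∫ t in Set.Icc (0:ℝ) (2 * Real.pi),
        Complex.exp ((N x : ℂ) * (Complex.I * (t : ℂ))) = 0 := by
      rw [integral_Icc_eq_integral_Ioc,
        ← intervalIntegral.integral_of_le (by positivity)]
      have hc : (N x : ℂ) * Complex.I ≠ 0 := by simp [hN]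
      have := integral_exp_mul_complex (a := 0) (b := 2 * Real.pi) hc
      simp_rw [mul_assoc] at this
      rw [this]
      have h2 : Complex.exp ((N x : ℂ) * (Complex.I * ((2 * Real.pi : ℝ) : ℂ))) = 1 := by
        rw [Complex.exp_eq_one_iff]
        exact ⟨N x, by push_cast; ring⟩
      rw [h2]; simp
    rw [h0]
    simp_rw [mul_add, Complex.exp_add]
    rw [integral_const_mul, h0, mul_zero]

lemma sum_modes {R : Type*} [Fintype R] [DecidableEq R] {n : ℕ} (p : Fin n → R × R) (z : R → ℂ) :
    ∑ i, (z (p i).1 - z (p i).2) = ∑ x, ((∑ i, ((if (p i).1 = x then 1 else 0)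
      - (if (p i).2 = x then 1 else 0)) : ℤ) : ℂ) * z x := by
  push_cast
  simp_rw [Finset.sum_mul]
  rw [Finset.sum_comm]
  refine Finset.sum_congr rfl fun i _ => ?_
  simp [sub_mul, Finset.sum_sub_distrib]

lemma torus_pow {R : Type*} [Fintype R] [DecidableEq R] (C : R → R → ℂ) (ρ : R → ℂ) (n : ℕ) :
    ∫ θ in Set.univ.pi (fun _ : R => Set.Icc (0:ℝ) (2 * Real.pi)),
      (∑ x, ∑ y, C x y *
        Complex.exp ((ρ x + Complex.I * (θ x : ℂ)) - (ρ y + Complex.I * (θ y : ℂ)))) ^ n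
    = ∫ θ in Set.univ.pi (fun _ : R => Set.Icc (0:ℝ) (2 * Real.pi)),
      (∑ x, ∑ y, C x y *
        Complex.exp ((Complex.I * (θ x : ℂ)) - (Complex.I * (θ y : ℂ)))) ^ n := by
  have key : ∀ z : R → ℂ, (∑ x, ∑ y, C x y * Complex.exp (z x - z y)) ^ n
      = ∑ p : Fin n → R × R, (∏ i, C (p i).1 (p i).2) *
        Complex.exp (∑ x, ((∑ i, ((if (p i).1 = x then 1 else 0)
          - (if (p i).2 = x then 1 else 0)) : ℤ) : ℂ) * z x) := by
    intro z
    rw [← Fintype.sum_prod_type' (f := fun x y => C x y * Complex.exp (z x - z y)),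
      Fintype.sum_pow]
    refine Finset.sum_congr rfl fun p _ => ?_
    rw [Finset.prod_mul_distrib, ← Complex.exp_sum, sum_modes]
  have hK : IsCompact (Set.univ.pi (fun _ : R => Set.Icc (0:ℝ) (2 * Real.pi))) :=
    isCompact_univ_pi fun _ => isCompact_Icc
  simp_rw [fun θ : R → ℝ => key (fun x => ρ x + Complex.I * (θ x : ℂ)),
    fun θ : R → ℝ => key (fun x => Complex.I * (θ x : ℂ))]
  rw [integral_finsetSum, integral_finsetSum]
  · refine Finset.sum_congr rfl fun p _ => ?_
    rw [integral_const_mul, integral_const_mul, torus_mode]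
  · intro p _
    exact (Continuous.continuousOn (by fun_prop)).integrableOn_compact hK
  · intro p _
    exact (Continuous.continuousOn (by fun_prop)).integrableOn_compact hK

lemma torus_hasSum {R : Type*} [Fintype R] [DecidableEq R] (S : (R → ℝ) → ℂ) (hS : Continuous S) :
    HasSum (fun n : ℕ => ∫ θ in Set.univ.pi (fun _ : R => Set.Icc (0:ℝ) (2 * Real.pi)),
        ((n.factorial : ℂ)⁻¹ * S θ ^ n))
      (∫ θ in Set.univ.pi (fun _ : R => Set.Icc (0:ℝ) (2 * Real.pi)), Complex.exp (S θ)) := by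
  have hK : IsCompact (Set.univ.pi (fun _ : R => Set.Icc (0:ℝ) (2 * Real.pi))) :=
    isCompact_univ_pi fun _ => isCompact_Icc
  obtain ⟨B, hB⟩ := hK.exists_bound_of_continuousOn hS.continuousOn
  have hfin : IsFiniteMeasure
    ((volume : Measure (R → ℝ)).restrict (Set.univ.pi (fun _ : R => Set.Icc (0:ℝ) (2 * Real.pi)))) :=
    ⟨by rw [Measure.restrict_apply_univ]; exact hK.measure_lt_top⟩
  refine hasSum_integral_of_dominated_convergence (fun n _ => B ^ n / n.factorial) ?_ ?_ ?_ ?_ ?_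
  · intro n
    exact (Continuous.aestronglyMeasurable (by fun_prop))
  · intro n
    refine (ae_restrict_iff' hK.measurableSet).2 (Filter.Eventually.of_forall fun θ hθ => ?_)
    rw [norm_mul, norm_inv, norm_pow, Complex.norm_natCast, div_eq_inv_mul]
    gcongr
    exact hB θ hθ
  · exact Filter.Eventually.of_forall fun θ => Real.summable_pow_div_factorial B
  · exact integrable_const _
  · refine Filter.Eventually.of_forall fun θ => ?_
    have := NormedSpace.expSeries_div_hasSum_exp (S θ)
    rw [← Complex.exp_eq_exp_ℂ] at this
    simpa [div_eq_inv_mul] using this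

lemma torus_exp {R : Type*} [Fintype R] [DecidableEq R] (C : R → R → ℂ) (ρ : R → ℂ) :
    ∫ θ in Set.univ.pi (fun _ : R => Set.Icc (0:ℝ) (2 * Real.pi)),
      Complex.exp (∑ x, ∑ y, C x y *
        Complex.exp ((ρ x + Complex.I * (θ x : ℂ)) - (ρ y + Complex.I * (θ y : ℂ))))
    = ∫ θ in Set.univ.pi (fun _ : R => Set.Icc (0:ℝ) (2 * Real.pi)),
      Complex.exp (∑ x, ∑ y, C x y *
        Complex.exp ((Complex.I * (θ x : ℂ)) - (Complex.I * (θ y : ℂ)))) := by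
  have h1 := torus_hasSum (fun θ : R → ℝ => ∑ x, ∑ y, C x y *
        Complex.exp ((ρ x + Complex.I * (θ x : ℂ)) - (ρ y + Complex.I * (θ y : ℂ)))) (by fun_prop)
  have h2 := torus_hasSum (fun θ : R → ℝ => ∑ x, ∑ y, C x y *
        Complex.exp ((Complex.I * (θ x : ℂ)) - (Complex.I * (θ y : ℂ)))) (by fun_prop)
  simp_rw [integral_const_mul, torus_pow] at h1
  simp_rw [integral_const_mul] at h2
  exact h1.unique h2

lemma GM_conj {R : Type*} [Fintype R] [DecidableEq R] (B : Matrix R R ℝ) (r : R → ℝ)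
    (hr : ∀ x, 0 < r x) (l : R → ℝ) :
    GM (Matrix.of fun x y => r x * B x y * (r y)⁻¹) l = GM B l := by
  unfold GM
  congr 1
  have := torus_exp (fun x y => (B x y : ℂ) * (Real.sqrt (l x * l y) : ℂ))
    (fun x => (Real.log (r x) : ℂ))
  simp_rw [← mul_sub] at this
  rw [← this]
  refine setIntegral_congr_fun (MeasurableSet.univ_pi fun _ => measurableSet_Icc) fun θ _ => ?_
  congr 1
  refine Finset.sum_congr rfl fun x _ => Finset.sum_congr rfl fun y _ => ?_
  have : Complex.exp ((Real.log (r x) : ℂ) + Complex.I * (θ x : ℂ)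
      - ((Real.log (r y) : ℂ) + Complex.I * (θ y : ℂ)))
      = (r x : ℂ) * (r y : ℂ)⁻¹ * Complex.exp (Complex.I * ((θ x : ℂ) - (θ y : ℂ))) := by
    rw [show (Real.log (r x) : ℂ) + Complex.I * (θ x : ℂ)
      - ((Real.log (r y) : ℂ) + Complex.I * (θ y : ℂ)) = (Real.log (r x) : ℂ) +
      -(Real.log (r y) : ℂ) + Complex.I * ((θ x : ℂ) - (θ y : ℂ)) by ring,
      Complex.exp_add, Complex.exp_add, Complex.exp_neg, ← Complex.ofReal_exp,
      ← Complex.ofReal_exp, Real.exp_log (hr x), Real.exp_log (hr y)]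
  rw [this]
  simp only [Matrix.of_apply]
  push_cast
  ring

lemma GM_diag {R : Type*} [Fintype R] [DecidableEq R] (A B : Matrix R R ℝ)
    (hB : ∀ x y, B x y = if x = y then 0 else A x y) (l : R → ℝ) (hl : ∀ x, 0 < l x) :
    GM A l = Complex.exp (∑ x, (A x x : ℂ) * (l x : ℂ)) * GM B l := by
  unfold GM
  rw [mul_left_comm]
  congr 1
  rw [← integral_const_mul]
  refine setIntegral_congr_fun (MeasurableSet.univ_pi fun _ => measurableSet_Icc) fun θ _ => ?_
  rw [← Complex.exp_add, ← Finset.sum_add_distrib]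
  congr 1
  refine Finset.sum_congr rfl fun x _ => ?_
  rw [← Finset.add_sum_erase _ _ (Finset.mem_univ x),
    ← Finset.add_sum_erase (f := fun y => (B x y : ℂ) * (Real.sqrt (l x * l y) : ℂ) *
        Complex.exp (Complex.I * ((θ x : ℂ) - (θ y : ℂ)))) _ (Finset.mem_univ x)]
  rw [hB x x, Real.sqrt_mul_self (hl x).le]
  simp only [if_true, sub_self, mul_zero, Complex.exp_zero, mul_one, Complex.ofReal_zero, zero_mul,
    zero_add]
  congr 1
  refine Finset.sum_congr rfl fun y hy => ?_
  rw [hB x y, if_neg (Finset.ne_of_mem_erase hy).symm]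
lemma contDiff_integral_param {E F : Type*} [NormedAddCommGroup E] [NormedSpace ℝ E]
    [FiniteDimensional ℝ E] [NormedAddCommGroup F] [NormedSpace ℝ F] [MeasurableSpace F]
    [BorelSpace F] [FiniteDimensional ℝ F]
    (μ : Measure F) [IsFiniteMeasureOnCompacts μ] (K : Set F) (hK : IsCompact K) (n : ℕ) :
    ∀ φ : E × F → ℂ, ContDiff ℝ (⊤ : ℕ∞) φ → 
      ContDiff ℝ n (fun s => ∫ θ in K, φ (s, θ) ∂μ) := by
  have main : ∀ φ : E × F → ℂ, ContDiff ℝ (⊤ : ℕ∞) φ → ∀ s₀ : E,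
      HasFDerivAt (fun s => ∫ θ in K, φ (s, θ) ∂μ)
        (∫ θ in K, (fderiv ℝ φ (s₀, θ)).comp (ContinuousLinearMap.inl ℝ E F) ∂μ) s₀ := by
    intro φ hφ s₀
    have hφc := hφ.continuous
    have hφ' : Continuous (fun p : E × F =>
        (fderiv ℝ φ p).comp (ContinuousLinearMap.inl ℝ E F)) :=
      (hφ.continuous_fderiv (by simp)).clm_comp continuous_const
    obtain ⟨B, hB⟩ := ((isCompact_closedBall s₀ 1).prod hK).exists_bound_of_continuousOn
      hφ'.continuousOn
    have hfin : IsFiniteMeasure (μ.restrict K) :=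
      ⟨by rw [Measure.restrict_apply_univ]; exact hK.measure_lt_top⟩
    refine hasFDerivAt_integral_of_dominated_of_fderiv_le (s := Metric.closedBall s₀ 1)
      (F' := fun s θ => (fderiv ℝ φ (s, θ)).comp (ContinuousLinearMap.inl ℝ E F))
      (bound := fun _ => B)
      (Metric.closedBall_mem_nhds s₀ one_pos) ?_ ?_ ?_ ?_ ?_ ?_
    · exact Filter.Eventually.of_forall fun s => Continuous.aestronglyMeasurable (by fun_prop)
    · exact (Continuous.continuousOn (by fun_prop)).integrableOn_compact hK
    · exact (hφ'.comp (by fun_prop : Continuous fun θ : F => (s₀, θ))).aestronglyMeasurable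
    · exact (ae_restrict_iff' hK.measurableSet).2
        (Filter.Eventually.of_forall fun θ hθ s hs => hB (s, θ) ⟨hs, hθ⟩)
    · exact integrable_const _
    · refine Filter.Eventually.of_forall fun θ s _ => ?_
      have h1 : HasFDerivAt φ (fderiv ℝ φ (s, θ)) (s, θ) :=
        (hφ.differentiable (by simp) (s, θ)).hasFDerivAt
      exact h1.comp s (hasFDerivAt_prodMk_left s θ)
  induction n with
  | zero =>
    intro φ hφ
    rw [Nat.cast_zero, contDiff_zero]
    exact continuous_iff_continuousAt.2 fun s => (main φ hφ s).continuousAt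
  | succ n ih =>
    intro φ hφ
    rw [Nat.cast_add, Nat.cast_one, contDiff_succ_iff_fderiv_apply]
    refine ⟨fun s => (main φ hφ s).differentiableAt, by simp, fun y => ?_⟩
    have hφ' : Continuous (fun p : E × F =>
        (fderiv ℝ φ p).comp (ContinuousLinearMap.inl ℝ E F)) :=
      (hφ.continuous_fderiv (by simp)).clm_comp continuous_const
    have h2 : (fun s => fderiv ℝ (fun s => ∫ θ in K, φ (s, θ) ∂μ) s y)
        = fun s => ∫ θ in K, (fun p : E × F => fderiv ℝ φ p (y, 0)) (s, θ) ∂μ := by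
      funext s
      rw [(main φ hφ s).fderiv, ContinuousLinearMap.integral_apply]
      · simp
      · exact (hφ'.comp (by fun_prop : Continuous fun θ : F => (s, θ))).continuousOn.integrableOn_compact hK
    rw [h2]
    refine ih (fun p : E × F => fderiv ℝ φ p (y, 0)) ?_
    exact (hφ.fderiv_right (m := (⊤ : ℕ∞)) (by simp)).clm_apply contDiff_const

lemma GM_contDiffOn {R : Type*} [Fintype R] [DecidableEq R] (M : Matrix R R ℝ) :
    ContDiffOn ℝ (⊤ : ℕ∞) (GM M) {l : R → ℝ | ∀ x, 0 < l x} := by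
  rw [contDiffOn_infty]
  intro n
  let φ : (R → ℝ) × (R → ℝ) → ℂ := fun p =>
    Complex.exp (∑ x, ∑ y, (M x y : ℂ) * ((p.1 x * p.1 y : ℝ) : ℂ) *
        Complex.exp (Complex.I * ((p.2 x : ℂ) - (p.2 y : ℂ))))
  have hφ : ContDiff ℝ (⊤ : ℕ∞) φ := by
    have h1 : ∀ x : R, ContDiff ℝ (⊤ : ℕ∞) fun p : (R → ℝ) × (R → ℝ) => (p.2 x : ℂ) := fun x =>
      Complex.ofRealCLM.contDiff.comp (by fun_prop)
    have h2 : ∀ x y : R, ContDiff ℝ (⊤ : ℕ∞)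
      fun p : (R → ℝ) × (R → ℝ) => ((p.1 x * p.1 y : ℝ) : ℂ) := fun x y =>
      Complex.ofRealCLM.contDiff.comp (ContDiff.mul (by fun_prop) (by fun_prop))
    refine ContDiff.cexp (ContDiff.sum fun x _ => ContDiff.sum fun y _ => ?_)
    exact (contDiff_const.mul (h2 x y)).mul
      (ContDiff.cexp (contDiff_const.mul ((h1 x).sub (h1 y))))
  have hK : IsCompact (Set.univ.pi (fun _ : R => Set.Icc (0:ℝ) (2 * Real.pi))) :=
    isCompact_univ_pi fun _ => isCompact_Icc
  have h := contDiff_integral_param (volume : Measure (R → ℝ)) _ hK n φ hφ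
  have hs : ContDiffOn ℝ n (fun (l : R → ℝ) (x : R) => Real.sqrt (l x)) {l : R → ℝ | ∀ x, 0 < l x} := by
    rw [contDiffOn_pi]
    intro x
    exact ContDiffOn.sqrt (by fun_prop) fun l hl => (hl x).ne'
  have h3 := contDiffOn_const (c := ((2 * Real.pi : ℂ) ^ (Fintype.card R))⁻¹) (𝕜 := ℝ) (n := n)
    (s := {l : R → ℝ | ∀ x, 0 < l x}) |>.mul (h.comp_contDiffOn hs)
  refine h3.congr fun l hl => ?_
  unfold GM
  simp only [φ, Function.comp]
  congr 1
  refine setIntegral_congr_fun hK.measurableSet fun θ _ => ?_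
  congr 1
  refine Finset.sum_congr rfl fun x _ => Finset.sum_congr rfl fun y _ => ?_
  rw [Real.sqrt_mul (hl x).le]
lemma orthant_isOpen {R : Type*} [Fintype R] : IsOpen {l : R → ℝ | ∀ x, 0 < l x} := by
  simp only [Set.ofPred_forall]
  exact isOpen_iInter_of_finite fun x => isOpen_lt continuous_const (continuous_apply x)

section diffop
variable {R : Type*} [Fintype R] [DecidableEq R] {U : Set (R → ℝ)}

lemma pd_congr (hU : IsOpen U) {f g : (R → ℝ) → ℂ} (h : Set.EqOn f g U) (x : R) :
    Set.EqOn (pd x f) (pd x g) U := by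
  intro l hl
  unfold pd
  rw [Filter.EventuallyEq.fderiv_eq (h.eventuallyEq_of_mem (hU.mem_nhds hl))]

lemma foldr_pd_congr (hU : IsOpen U) {f g : (R → ℝ) → ℂ} (h : Set.EqOn f g U) (L : List R) :
    Set.EqOn (L.foldr pd f) (L.foldr pd g) U := by
  induction L with
  | nil => exact h
  | cons x L ih => exact pd_congr hU ih x

lemma pd_smooth_s8 (hU : IsOpen U) {f : (R → ℝ) → ℂ} (h : ContDiffOn ℝ (⊤ : ℕ∞) f U) (x : R) :
    ContDiffOn ℝ (⊤ : ℕ∞) (pd x f) U :=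
  (h.fderiv_of_isOpen hU (by simp)).clm_apply contDiffOn_const

lemma foldr_pd_smooth (hU : IsOpen U) {f : (R → ℝ) → ℂ} (h : ContDiffOn ℝ (⊤ : ℕ∞) f U)
    (L : List R) : ContDiffOn ℝ (⊤ : ℕ∞) (L.foldr pd f) U := by
  induction L with
  | nil => exact h
  | cons x L ih => exact pd_smooth_s8 hU ih x

lemma pd_comm_s8 (hU : IsOpen U) {f : (R → ℝ) → ℂ} (h : ContDiffOn ℝ (⊤ : ℕ∞) f U) (x y : R) :
    Set.EqOn (pd x (pd y f)) (pd y (pd x f)) U := by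
  intro l hl
  have hf : ContDiffAt ℝ (⊤ : ℕ∞) f l := h.contDiffAt (hU.mem_nhds hl)
  have h2 : (2 : WithTop ℕ∞) ≤ ((⊤ : ℕ∞) : WithTop ℕ∞) :=
    WithTop.coe_le_coe.2 (le_top : (2 : ℕ∞) ≤ ⊤)
  have hsymm : IsSymmSndFDerivAt ℝ f l := hf.isSymmSndFDerivAt (by simpa using h2)
  have hd : DifferentiableAt ℝ (fderiv ℝ f) l :=
    (hf.fderiv_right (m := 1) (by rw [one_add_one_eq_two]; exact h2)).differentiableAt (by simp)
  have key : ∀ x y : R, pd x (pd y f) l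
      = fderiv ℝ (fderiv ℝ f) l (Pi.single x 1) (Pi.single y 1) := by
    intro x y
    unfold pd
    rw [fderiv_clm_apply hd (differentiableAt_const _)]
    simp
  rw [key, key, hsymm]

lemma foldr_pd_perm (hU : IsOpen U) {L L' : List R} (hp : L.Perm L') :
    ∀ {f : (R → ℝ) → ℂ}, ContDiffOn ℝ (⊤ : ℕ∞) f U →
    Set.EqOn (L.foldr pd f) (L'.foldr pd f) U := by
  induction hp with
  | nil => intro f _ l _; rfl
  | cons x _ ih => intro f h; exact pd_congr hU (ih h) x
  | swap x y L =>
    intro f h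
    exact pd_comm_s8 hU (foldr_pd_smooth hU h L) y x
  | trans _ _ ih1 ih2 => intro f h; exact (ih1 h).trans (ih2 h)

lemma mpart_insert_s8 (hU : IsOpen U) {f : (R → ℝ) → ℂ} (h : ContDiffOn ℝ (⊤ : ℕ∞) f U)
    {x : R} {Q : Finset R} (hx : x ∉ Q) :
    Set.EqOn (mpart (insert x Q) f) (pd x (mpart Q f)) U :=
  foldr_pd_perm hU (Finset.toList_insert hx) h

lemma mpart_smooth (hU : IsOpen U) {f : (R → ℝ) → ℂ} (h : ContDiffOn ℝ (⊤ : ℕ∞) f U)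
    (Q : Finset R) : ContDiffOn ℝ (⊤ : ℕ∞) (mpart Q f) U := foldr_pd_smooth hU h _

lemma hasFDerivAt_expLin (d : R → ℂ) (l : R → ℝ) :
    HasFDerivAt (fun l : R → ℝ => Complex.exp (∑ x, d x * (l x : ℂ)))
      (Complex.exp (∑ x, d x * (l x : ℂ)) •
        ∑ x, d x • (Complex.ofRealCLM.comp (ContinuousLinearMap.proj (R := ℝ) x))) l := by
  refine HasFDerivAt.cexp ?_
  refine HasFDerivAt.fun_sum fun x _ => ?_
  exact ((Complex.ofRealCLM.comp (ContinuousLinearMap.proj (R := ℝ) (φ := fun _ : R => ℝ) x)).hasFDerivAt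
    (x := l)).const_mul (d x)

lemma expLin_smooth (d : R → ℂ) :
    ContDiff ℝ (⊤ : ℕ∞) (fun l : R → ℝ => Complex.exp (∑ x, d x * (l x : ℂ))) := by
  refine ContDiff.cexp (ContDiff.sum fun x _ => contDiff_const.mul ?_)
  exact Complex.ofRealCLM.contDiff.comp (by fun_prop)

lemma mpart_exp_mul (hU : IsOpen U) {g : (R → ℝ) → ℂ} (h : ContDiffOn ℝ (⊤ : ℕ∞) g U)
    (d : R → ℂ) (Q : Finset R) :
    Set.EqOn (mpart Q (fun l => Complex.exp (∑ x, d x * (l x : ℂ)) * g l))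
      (fun l => Complex.exp (∑ x, d x * (l x : ℂ)) *
        ∑ P ∈ Q.powerset, (∏ x ∈ Q \ P, d x) * mpart P g l) U := by
  induction Q using Finset.induction_on with
  | empty => intro l _; simp [mpart]
  | insert x Q hx ih =>
    have hs : ContDiffOn ℝ (⊤ : ℕ∞) (fun l : R → ℝ => Complex.exp (∑ x, d x * (l x : ℂ)) * g l) U :=
      (expLin_smooth d).contDiffOn.mul h
    refine (mpart_insert_s8 hU hs hx).trans ((pd_congr hU ih x).trans ?_)
    intro l hl
    have hP : ∀ P : Finset R, HasFDerivAt (mpart P g) (fderiv ℝ (mpart P g) l) l := fun P =>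
      (((mpart_smooth hU h P).contDiffAt (hU.mem_nhds hl)).differentiableAt (by simp)).hasFDerivAt
    have hD := HasFDerivAt.fun_mul (hasFDerivAt_expLin d l)
      (HasFDerivAt.fun_sum (u := Q.powerset) fun P _ => (hP P).const_mul (∏ x ∈ Q \ P, d x))
    have hpd : pd x (fun l => Complex.exp (∑ x, d x * (l x : ℂ)) *
        ∑ P ∈ Q.powerset, (∏ x ∈ Q \ P, d x) * mpart P g l) l
        = Complex.exp (∑ x, d x * (l x : ℂ)) *
          (∑ P ∈ Q.powerset, (∏ x ∈ Q \ P, d x) * pd x (mpart P g) l)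
          + Complex.exp (∑ x, d x * (l x : ℂ)) * (d x *
            ∑ P ∈ Q.powerset, (∏ x ∈ Q \ P, d x) * mpart P g l) := by
      unfold pd
      rw [hD.fderiv]
      simp [Pi.single_apply, apply_ite (Complex.ofReal)]
      ring
    rw [hpd, ← mul_add, add_comm]
    simp only
    rw [Finset.sum_powerset_insert hx, Finset.mul_sum]
    congr 2
    · refine Finset.sum_congr rfl fun P hP => ?_
      have hxP : x ∉ P := fun h => hx (Finset.mem_powerset.1 hP h)
      rw [Finset.insert_sdiff_of_notMem _ hxP, Finset.prod_insert (by simp [hx]), mul_assoc]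
    · refine Finset.sum_congr rfl fun P hP => ?_
      have hxP : x ∉ P := fun h => hx (Finset.mem_powerset.1 hP h)
      rw [mpart_insert_s8 hU h hxP hl]
      congr 2
      ext u
      simp only [Finset.mem_sdiff, Finset.mem_insert]
      constructor
      · rintro ⟨h1, h2⟩
        exact ⟨Or.inr h1, fun h => h.elim (fun h => hx (h ▸ h1)) h2⟩
      · rintro ⟨h1, h2⟩
        tauto

end diffop
/-- **Proposition 2.5(ii).** With `B` the off-diagonal part of `A` and any
`r ∈ (0,∞)^R`, setting `B^{(r)}_{x,y} = r_x B_{x,y} r_y⁻¹`,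
`ρ_{ab}^{(R)}(l) = e^{Σ_x l_x A_{x,x}} (det_{ab}^{(R)}(−B + ∂_l) G_{B^{(r)}})(l)`
for all `l ∈ (0,∞)^R`. -/
theorem rho_eq_conjugated_offdiagonal_form
    {R : Type*} [Fintype R] [DecidableEq R]
    (A B : Matrix R R ℝ)
    (hB : ∀ x y, B x y = if x = y then 0 else A x y)
    (r : R → ℝ) (hr : ∀ x, 0 < r x)
    (a b : R) (l : R → ℝ) (hl : ∀ x, 0 < l x) :
    rho A a b l
      = Complex.exp ((∑ x, l x * A x x : ℝ) : ℂ) *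
        ddet ((-B).map (fun c => (c : ℂ))) a b
          (GM (Matrix.of fun x y => r x * B x y * (r y)⁻¹)) l := by
  have hconj : GM (Matrix.of fun x y => r x * B x y * (r y)⁻¹) = GM B :=
    funext fun l => GM_conj B r hr l
  rw [hconj]
  have hU : IsOpen {l : R → ℝ | ∀ x, 0 < l x} := orthant_isOpen
  set d : R → ℂ := fun x => (A x x : ℂ) with hd
  have hmp : ∀ Q : Finset R, mpart Q (GM A) l = Complex.exp (∑ x, d x * (l x : ℂ)) *
        ∑ P ∈ Q.powerset, (∏ x ∈ Q \ P, d x) * mpart P (GM B) l := fun Q =>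
    (foldr_pd_congr hU (fun l hl => GM_diag A B hB l hl) Q.toList hl).trans
      (mpart_exp_mul hU (GM_contDiffOn B) d Q hl)
  have hE : Complex.exp ((∑ x, l x * A x x : ℝ) : ℂ) = Complex.exp (∑ x, d x * (l x : ℂ)) := by
    congr 1
    push_cast
    exact Finset.sum_congr rfl fun x _ => mul_comm _ _
  rw [hE]
  set V : Finset R := (Finset.univ : Finset R) \ {a, b} with hV
  have hcof : ∀ P ∈ V.powerset,
      cofDet ((Finset.univ : Finset R) \ P) ((-B).map (fun c => (c : ℂ))) a b
      = ∑ T ∈ (V \ P).powerset, (∏ x ∈ T, d x) *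
        cofDet (((Finset.univ : Finset R) \ P) \ T) ((-A).map (fun c => (c : ℂ))) a b := by
    intro P _
    rw [← cofDet_expand a b d _ (V \ P) _
      (Finset.sdiff_subset_sdiff (Finset.subset_univ _) le_rfl) (by simp [hV]) (by simp [hV])]
    refine cofDet_congr _ _ _ _ _ fun u v hu hv huS _ => ?_
    simp only [Matrix.map_apply, Matrix.neg_apply, Matrix.of_apply, hB]
    by_cases huv : u = v
    · subst huv
      have hmem : u ∈ V \ P := by
        simp only [Finset.mem_sdiff, Finset.mem_univ, true_and] at huS
        simp [hV, hu, hv, huS]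
      simp [hmem, hd]
    · simp [huv]
  unfold rho ddet
  rw [Finset.mul_sum]
  simp_rw [hmp]
  have hR : ∑ P ∈ V.powerset, Complex.exp (∑ x, d x * (l x : ℂ)) *
      (cofDet ((Finset.univ : Finset R) \ P) ((-B).map (fun c => (c : ℂ))) a b * mpart P (GM B) l)
      = ∑ P ∈ V.powerset, Complex.exp (∑ x, d x * (l x : ℂ)) *
      ((∑ T ∈ (V \ P).powerset, (∏ x ∈ T, d x) *
        cofDet (((Finset.univ : Finset R) \ P) \ T) ((-A).map (fun c => (c : ℂ))) a b)
        * mpart P (GM B) l) :=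
    Finset.sum_congr rfl fun P hP => by rw [hcof P hP]
  rw [hR]
  simp_rw [Finset.mul_sum, Finset.sum_mul, Finset.mul_sum]
  rw [Finset.sum_sigma', Finset.sum_sigma']
  refine Finset.sum_bij' (fun p _ => ⟨p.2, p.1 \ p.2⟩) (fun p _ => ⟨p.1 ∪ p.2, p.1⟩) ?_ ?_ ?_ ?_ ?_
  · rintro ⟨Q, P⟩ h
    simp only [Finset.mem_sigma, Finset.mem_powerset] at h ⊢
    exact ⟨h.2.trans h.1, Finset.sdiff_subset_sdiff h.1 le_rfl⟩
  · rintro ⟨P, T⟩ h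
    simp only [Finset.mem_sigma, Finset.mem_powerset] at h ⊢
    exact ⟨Finset.union_subset h.1 (h.2.trans Finset.sdiff_subset), Finset.subset_union_left⟩
  · rintro ⟨Q, P⟩ h
    simp only [Finset.mem_sigma, Finset.mem_powerset] at h ⊢
    rw [Finset.union_sdiff_of_subset h.2]
  · rintro ⟨P, T⟩ h
    simp only [Finset.mem_sigma, Finset.mem_powerset] at h ⊢
    have : (P ∪ T) \ P = T := by
      rw [Finset.union_sdiff_left]
      exact Finset.sdiff_eq_self_of_disjoint
        (Finset.disjoint_of_subset_left h.2 Finset.sdiff_disjoint)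
    rw [this]
  · rintro ⟨Q, P⟩ h
    simp only [Finset.mem_sigma, Finset.mem_powerset] at h ⊢
    have : ((Finset.univ : Finset R) \ P) \ (Q \ P) = Finset.univ \ Q := by
      ext u
      have := @h.2 u
      simp only [Finset.mem_sdiff, Finset.mem_univ, true_and]
      tauto
    rw [this]
    ring

end
end
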